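/- Let u : ℝⁿ → ℝ be k-polyharmonic (Δᵏu = 0 on ℝⁿ) for some integer k ≥ 1, and suppose u has sublinear growth: sup_{B_r}|u| = o(r) as r → ∞. Then u is constant. -/

import Mathlib

open MeasureTheory Metric Filter
open scoped Topology RealInnerProductSpace

/-- The Euclidean Laplacian of `f : ℝⁿ → ℝ`. -/
noncomputable def lap {n : ℕ} (f : EuclideanSpace ℝ (Fin n) → ℝ)
    (x : EuclideanSpace ℝ (Fin n)) : ℝ :=
  ∑ i : Fin n,
    fderiv ℝ (fun y => fderiv ℝ f y (EuclideanSpace.single i 1)) x (EuclideanSpace.single i 1)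

/-- The truncated paraboloid `z ↦ (1 - ‖z‖²)₊ ^ (m + 1)`. -/
noncomputable def bump {n : ℕ} (m : ℕ) (z : EuclideanSpace ℝ (Fin n)) : ℝ :=
  max (1 - ‖z‖ ^ 2) 0 ^ (m + 1)

section Polyharmonic

variable {n : ℕ}

local notation "E" => EuclideanSpace ℝ (Fin n)

lemma hasDerivAt_max_zero_pow (m : ℕ) (t : ℝ) :
    HasDerivAt (fun s : ℝ => max s 0 ^ (m + 2)) ((m + 2) * max t 0 ^ (m + 1)) t := by
  rcases lt_trichotomy t 0 with h | rfl | h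
  · have h0 : (fun s : ℝ => max s 0 ^ (m + 2)) =ᶠ[𝓝 t] fun _ => 0 := by
      filter_upwards [eventually_lt_nhds h] with s hs
      simp [max_eq_right hs.le]
    simpa [max_eq_right h.le] using (hasDerivAt_const t (0 : ℝ)).congr_of_eventuallyEq h0
  · rw [hasDerivAt_iff_isLittleO]
    have hO : (fun s : ℝ => max s 0 ^ (m + 2)) =O[𝓝 0] fun s => s ^ (m + 2) := by
      refine Asymptotics.isBigO_of_le _ fun s => ?_
      rw [norm_pow, norm_pow]
      gcongr
      rcases le_total s 0 with hs | hs <;> simp [hs]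
    simpa using hO.trans_isLittleO (Asymptotics.isLittleO_pow_id (by omega : 1 < m + 2))
  · have h0 : (fun s : ℝ => max s 0 ^ (m + 2)) =ᶠ[𝓝 t] fun s => s ^ (m + 2) := by
      filter_upwards [eventually_gt_nhds h] with s hs
      simp [max_eq_left hs.le]
    simpa [max_eq_left h.le] using (hasDerivAt_pow (m + 2) t).congr_of_eventuallyEq h0

lemma continuous_bump (m : ℕ) : Continuous (bump m : E → ℝ) := by
  unfold bump
  fun_prop

lemma bump_nonneg (m : ℕ) (z : E) : 0 ≤ bump m z := by
  unfold bump
  positivity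

lemma bump_eq_zero (m : ℕ) {z : E} (hz : 1 ≤ ‖z‖) : bump m z = 0 := by
  have : 1 - ‖z‖ ^ 2 ≤ 0 := by nlinarith
  simp [bump, max_eq_right this]

lemma hasCompactSupport_bump (m : ℕ) : HasCompactSupport (bump m : E → ℝ) :=
  HasCompactSupport.intro (isCompact_closedBall (0 : E) 1) fun z hz =>
    bump_eq_zero m (by simpa using (not_le.1 (by simpa using hz)).le)

lemma integral_bump_pos (m : ℕ) : 0 < ∫ z : E, bump m z :=
  (continuous_bump m).integral_pos_of_hasCompactSupport_nonneg_nonzero (hasCompactSupport_bump m)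
    (bump_nonneg m) (x := 0) (by simp [bump])

lemma hasFDerivAt_bump_succ (m : ℕ) (z : E) :
    HasFDerivAt (bump (m + 1)) ((-(2 * (m + 2)) * bump m z) • innerSL ℝ z) z := by
  have h := (hasDerivAt_max_zero_pow m (1 - ‖z‖ ^ 2)).comp_hasFDerivAt z
    ((hasStrictFDerivAt_norm_sq z).hasFDerivAt.const_sub 1)
  refine h.congr_fderiv ?_
  ext v
  simp [bump]
  ring

lemma fderiv_bump_succ (m : ℕ) (z v : E) :
    fderiv ℝ (bump (m + 1)) z v = -(2 * (m + 2)) * bump m z * inner ℝ z v := by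
  simp [(hasFDerivAt_bump_succ m z).fderiv]

lemma integrable_mul_bump (m : ℕ) {f : E → ℝ} (hf : Continuous f) :
    Integrable fun z => f z * bump m z :=
  (hf.mul (continuous_bump m)).integrable_of_hasCompactSupport (hasCompactSupport_bump m).mul_left

lemma integrable_mul_fderiv_bump_succ (m : ℕ) {f : E → ℝ} (hf : Continuous f) (v : E) :
    Integrable fun z => f z * fderiv ℝ (bump (m + 1)) z v := by
  have : Continuous fun z : E => f z * (-(2 * (m + 2)) * inner ℝ z v) := by fun_prop
  refine (integrable_mul_bump m this).congr (.of_forall fun z => ?_)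
  simp only [fderiv_bump_succ]
  ring

/-- The mean of `u` over the ball of radius `|r|` about `x`, with weight `bump m`
(not normalised). -/
noncomputable def bumpMean (m : ℕ) (u : E → ℝ) (x : E) (r : ℝ) : ℝ :=
  ∫ z : E, u (x + r • z) * bump m z

lemma hasDerivAt_bumpMean (m : ℕ) {u : E → ℝ} (hu : ContDiff ℝ 1 u) (x : E) (r : ℝ) :
    HasDerivAt (bumpMean m u x) (∫ z : E, fderiv ℝ u (x + r • z) z * bump m z) r := by
  have hdu : Continuous (fderiv ℝ u) := hu.continuous_fderiv (by norm_num)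
  have hc : Continuous fun p : ℝ × E => fderiv ℝ u (x + p.1 • p.2) p.2 := by
    fun_prop
  obtain ⟨C, hC⟩ := ((isCompact_closedBall r 1).prod
    (isCompact_closedBall (0 : E) 1)).exists_bound_of_continuousOn hc.continuousOn
  refine (hasDerivAt_integral_of_dominated_loc_of_deriv_le (s := closedBall r 1)
    (bound := fun z => C * bump m z)
    (F := fun r z => u (x + r • z) * bump m z)
    (F' := fun r z => fderiv ℝ u (x + r • z) z * bump m z)
    (closedBall_mem_nhds r one_pos) ?_ ?_ ?_ ?_ ?_ ?_).2
  · refine .of_forall fun s => (integrable_mul_bump m ?_).aestronglyMeasurable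
    exact hu.continuous.comp (by fun_prop)
  · exact integrable_mul_bump m (hu.continuous.comp (by fun_prop))
  · exact (integrable_mul_bump m (by fun_prop)).aestronglyMeasurable
  · refine .of_forall fun z s hs => ?_
    rw [norm_mul, Real.norm_of_nonneg (bump_nonneg m z)]
    rcases le_total 1 ‖z‖ with hz | hz
    · simp [bump_eq_zero m hz]
    · exact mul_le_mul_of_nonneg_right (hC (s, z) ⟨hs, by simpa using hz⟩) (bump_nonneg m z)
  · exact integrable_mul_bump m continuous_const
  · refine .of_forall fun z s _ => ?_
    have h1 : HasDerivAt (fun s : ℝ => x + s • z) z s := by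
      simpa using ((hasDerivAt_id s).smul_const z).const_add x
    exact (((hu.differentiable (by norm_num)) _).hasFDerivAt.comp_hasDerivAt s h1).mul_const _

/-- Integration by parts against `bump (m + 1)`. -/
lemma integral_mul_fderiv_bump_succ (m : ℕ) {u : E → ℝ} (hu : ContDiff ℝ 1 u) (x v : E) (r : ℝ) :
    ∫ z : E, u (x + r • z) * fderiv ℝ (bump (m + 1)) z v =
      -(r * bumpMean (m + 1) (fun y => fderiv ℝ u y v) x r) := by
  have hdu : Continuous (fderiv ℝ u) := hu.continuous_fderiv (by norm_num)
  have hd (z : E) : HasFDerivAt (fun z : E => u (x + r • z))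
      ((fderiv ℝ u (x + r • z)).comp (r • ContinuousLinearMap.id ℝ E)) z :=
    ((hu.differentiable (by norm_num)) _).hasFDerivAt.comp z
      (((hasFDerivAt_id z).const_smul r).const_add x)
  have hf (z : E) : fderiv ℝ (fun z : E => u (x + r • z)) z v = r * fderiv ℝ u (x + r • z) v := by
    simp [(hd z).fderiv]
  have hc : Continuous fun z : E => u (x + r • z) := hu.continuous.comp (by fun_prop)
  rw [integral_mul_fderiv_eq_neg_fderiv_mul_of_integrable]
  · simp_rw [hf, bumpMean, ← integral_const_mul, mul_assoc]
  · simp_rw [hf]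
    exact integrable_mul_bump _ (by fun_prop)
  · exact integrable_mul_fderiv_bump_succ m hc v
  · exact integrable_mul_bump _ hc
  · exact fun z _ => (hd z).differentiableAt
  · exact fun z _ => (hasFDerivAt_bump_succ m z).differentiableAt

lemma contDiff_fderiv_apply {u : E → ℝ} (hu : ContDiff ℝ (⊤ : ℕ∞) u) (v : E) :
    ContDiff ℝ (⊤ : ℕ∞) fun y => fderiv ℝ u y v :=
  (hu.fderiv_right (by simp)).clm_apply contDiff_const

lemma contDiff_lap {u : E → ℝ} (hu : ContDiff ℝ (⊤ : ℕ∞) u) : ContDiff ℝ (⊤ : ℕ∞) (lap u) := by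
  unfold lap
  exact ContDiff.sum fun i _ => contDiff_fderiv_apply (contDiff_fderiv_apply hu _) _

lemma hasDerivAt_bumpMean_lap (m : ℕ) {u : E → ℝ} (hu : ContDiff ℝ (⊤ : ℕ∞) u) (x : E) (r : ℝ) :
    HasDerivAt (bumpMean m u x) ((2 * (m + 2) : ℝ)⁻¹ * r * bumpMean (m + 1) (lap u) x r) r := by
  convert hasDerivAt_bumpMean m (hu.of_le (by simp)) x r using 1
  let e : Fin n → E := fun i => EuclideanSpace.single i 1
  have hsum (z : E) : fderiv ℝ u (x + r • z) z * bump m z =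
      ∑ i, -(2 * (m + 2) : ℝ)⁻¹ *
        (fderiv ℝ u (x + r • z) (e i) * fderiv ℝ (bump (m + 1)) z (e i)) := by
    have hz : z = ∑ i, z i • e i := by
      simpa [e] using ((EuclideanSpace.basisFun (Fin n) ℝ).sum_repr z).symm
    have h1 : fderiv ℝ u (x + r • z) z = ∑ i, z i * fderiv ℝ u (x + r • z) (e i) := by
      conv_lhs => rw [hz]
      rw [map_sum]
      simp only [map_smul, smul_eq_mul, ← hz]
    rw [h1, Finset.sum_mul]
    refine Finset.sum_congr rfl fun i _ => ?_
    rw [fderiv_bump_succ]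
    simp only [e, EuclideanSpace.inner_single_right]
    field_simp
    simp only [conj_trivial]
    ring
  have hD (i : Fin n) := contDiff_fderiv_apply hu (e i)
  have hcomp {f : E → ℝ} (hf : ContDiff ℝ (⊤ : ℕ∞) f) : Continuous fun z : E => f (x + r • z) :=
    hf.continuous.comp (by fun_prop)
  simp_rw [hsum]
  rw [integral_finsetSum _ fun i _ =>
    (integrable_mul_fderiv_bump_succ m (hcomp (hD i)) (e i)).const_mul _]
  simp_rw [integral_const_mul,
    fun i => integral_mul_fderiv_bump_succ m ((hD i).of_le (by simp)) x (e i) r]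
  have hlap : bumpMean (m + 1) (lap u) x r =
      ∑ i, bumpMean (m + 1) (fun y => fderiv ℝ (fun y => fderiv ℝ u y (e i)) y (e i)) x r := by
    unfold bumpMean
    rw [← integral_finsetSum _ fun i _ =>
      integrable_mul_bump (m + 1) (hcomp (contDiff_fderiv_apply (hD i) (e i)))]
    simp_rw [lap, Finset.sum_mul]
    rfl
  rw [hlap, Finset.mul_sum]
  refine Finset.sum_congr rfl fun i _ => ?_
  ring

lemma exists_derivative_eq {K : Type*} [Field K] [CharZero K] (q : Polynomial K) :
    ∃ p : Polynomial K, p.derivative = q := by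
  induction q using Polynomial.induction_on' with
  | add p q hp hq =>
    obtain ⟨p', rfl⟩ := hp
    obtain ⟨q', rfl⟩ := hq
    exact ⟨p' + q', Polynomial.derivative_add⟩
  | monomial d a =>
    refine ⟨Polynomial.monomial (d + 1) (a / (d + 1)), ?_⟩
    rw [Polynomial.derivative_monomial]
    have : (d + 1 : K) ≠ 0 := by exact_mod_cast d.succ_ne_zero
    simp [this]

/-- A Pizzetti-type formula: the weighted means of a polyharmonic function over balls are
polynomial in the radius. -/
lemma exists_polynomial_bumpMean (k : ℕ) : ∀ (m : ℕ) {u : E → ℝ}, ContDiff ℝ (⊤ : ℕ∞) u →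
    (∀ x, lap^[k] u x = 0) → ∀ x, ∃ p : Polynomial ℝ, ∀ r, bumpMean m u x r = p.eval r := by
  induction k with
  | zero =>
    intro m u _ h x
    exact ⟨0, fun r => by simp [bumpMean, show ∀ y, u y = 0 from h]⟩
  | succ k ih =>
    intro m u hu h x
    obtain ⟨q, hq⟩ := ih (m + 1) (contDiff_lap hu) h x
    obtain ⟨p, hp⟩ := exists_derivative_eq
      (Polynomial.C (2 * (m + 2) : ℝ)⁻¹ * Polynomial.X * q)
    have hd (r : ℝ) : HasDerivAt (fun r => bumpMean m u x r - p.eval r) 0 r := by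
      have := (hasDerivAt_bumpMean_lap m hu x r).sub (p.hasDerivAt r)
      rwa [hp, hq, Polynomial.eval_mul, Polynomial.eval_mul, Polynomial.eval_C, Polynomial.eval_X,
        sub_self (_ : ℝ)] at this
    refine ⟨p + Polynomial.C (bumpMean m u x 0 - p.eval 0), fun r => ?_⟩
    have := is_const_of_deriv_eq_zero (fun r => (hd r).differentiableAt) (fun r => (hd r).deriv) r 0
    rw [Polynomial.eval_add, Polynomial.eval_C]
    linarith

lemma fderiv_fderiv_apply_comm {u : E → ℝ} (hu : ContDiff ℝ (⊤ : ℕ∞) u) (v w x : E) :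
    fderiv ℝ (fun y => fderiv ℝ u y v) x w = fderiv ℝ (fun y => fderiv ℝ u y w) x v := by
  have hd : DifferentiableAt ℝ (fderiv ℝ u) x :=
    (hu.fderiv_right (m := (⊤ : ℕ∞)) (by simp)).differentiable (by simp) x
  have hs : IsSymmSndFDerivAt ℝ u x := hu.contDiffAt.isSymmSndFDerivAt
    (by simpa using WithTop.coe_le_coe.2 (le_top : (2 : ℕ∞) ≤ ⊤))
  rw [fderiv_clm_apply hd (by fun_prop), fderiv_clm_apply hd (by fun_prop)]
  simpa using hs.eq w v

lemma lap_fderiv_apply {u : E → ℝ} (hu : ContDiff ℝ (⊤ : ℕ∞) u) (v : E) :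
    lap (fun y => fderiv ℝ u y v) = fun y => fderiv ℝ (lap u) y v := by
  funext x
  unfold lap
  rw [fderiv_fun_sum fun i _ =>
    (contDiff_fderiv_apply (contDiff_fderiv_apply hu _) _).differentiable (by simp) x]
  rw [sum_apply]
  refine Finset.sum_congr rfl fun i _ => ?_
  simp_rw [fderiv_fderiv_apply_comm hu v]
  exact fderiv_fderiv_apply_comm (contDiff_fderiv_apply hu _) _ _ _

lemma iterate_lap_fderiv_apply (k : ℕ) : ∀ {u : E → ℝ}, ContDiff ℝ (⊤ : ℕ∞) u → ∀ v,
    lap^[k] (fun y => fderiv ℝ u y v) = fun y => fderiv ℝ (lap^[k] u) y v := by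
  induction k with
  | zero => intros; rfl
  | succ k ih =>
    intro u hu v
    rw [Function.iterate_succ_apply, Function.iterate_succ_apply, lap_fderiv_apply hu,
      ih (contDiff_lap hu)]

lemma abs_le_iSup_ball {u : E → ℝ} (hu : Continuous u) {r : ℝ} {y : E}
    (hy : y ∈ ball (0 : E) r) : |u y| ≤ ⨆ x ∈ ball (0 : E) r, |u x| := by
  obtain ⟨C, hC⟩ := (isCompact_closedBall (0 : E) r).exists_bound_of_continuousOn hu.continuousOn
  refine le_ciSup_of_le ⟨max C 0, ?_⟩ y (ciSup_pos (f := fun _ => |u y|) hy).ge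
  rintro _ ⟨z, rfl⟩
  refine Real.iSup_le (fun hz => ?_) (le_max_right _ _)
  exact (hC z (ball_subset_closedBall hz)).trans (le_max_left _ _)

/-- The weighted means of the derivative of a function of sublinear growth tend to zero. -/
lemma tendsto_bumpMean_fderiv_apply (m : ℕ) {u : E → ℝ} (hu : ContDiff ℝ 1 u)
    (hgrowth : (fun r : ℝ => ⨆ x ∈ ball (0 : E) r, |u x|) =o[atTop] (fun r : ℝ => r)) (x v : E) :
    Tendsto (bumpMean (m + 1) (fun y => fderiv ℝ u y v) x) atTop (𝓝 0) := by
  set S : ℝ → ℝ := fun r => ⨆ x ∈ ball (0 : E) r, |u x|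
  set a : ℝ := ‖x‖ + 1
  set A : ℝ := ∫ z : E, ‖fderiv ℝ (bump (m + 1)) z v‖
  have hS : (fun r => S (r + a)) =o[atTop] fun r : ℝ => r := by
    refine (hgrowth.comp_tendsto (tendsto_atTop_add_const_right _ a tendsto_id)).trans_isBigO ?_
    exact (Asymptotics.isBigO_refl _ _).add
      (Asymptotics.isLittleO_const_id_atTop a).isBigO
  have hlim : Tendsto (fun r => S (r + a) / r * A) atTop (𝓝 0) := by
    simpa using hS.tendsto_div_nhds_zero.mul_const A
  refine squeeze_zero_norm' ?_ hlim
  filter_upwards [eventually_gt_atTop 0] with r hr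
  have hparts := integral_mul_fderiv_bump_succ m hu x v r
  have hint : Integrable fun z : E => fderiv ℝ (bump (m + 1)) z v := by
    simpa using integrable_mul_fderiv_bump_succ m (continuous_const (y := (1 : ℝ))) v
  have hb : ‖∫ z : E, u (x + r • z) * fderiv ℝ (bump (m + 1)) z v‖ ≤ S (r + a) * A := by
    rw [← integral_const_mul]
    refine norm_integral_le_of_norm_le (hint.norm.const_mul _) (.of_forall fun z => ?_)
    rw [norm_mul]
    rcases le_total 1 ‖z‖ with hz | hz
    · simp [fderiv_bump_succ, bump_eq_zero m hz]
    · refine mul_le_mul_of_nonneg_right (abs_le_iSup_ball hu.continuous ?_) (norm_nonneg _)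
      rw [mem_ball_zero_iff]
      calc ‖x + r • z‖ ≤ ‖x‖ + r * ‖z‖ := by
            simpa [norm_smul, abs_of_pos hr] using norm_add_le x (r • z)
        _ < r + a := by
            have := mul_le_mul_of_nonneg_left hz hr.le
            simp only [a]
            linarith
  rw [hparts, norm_neg, norm_mul, Real.norm_of_nonneg hr.le] at hb
  rw [div_mul_eq_mul_div, le_div_iff₀ hr]
  linarith

end Polyharmonic

/-- Polyharmonic Liouville theorem: sublinear growth implies constant. -/
theorem polyharmonic_sublinear_is_constant (n : ℕ) (k : ℕ) (hk : 1 ≤ k)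
    (u : EuclideanSpace ℝ (Fin n) → ℝ) (hu : ContDiff ℝ (⊤ : ℕ∞) u)
    (hpoly : ∀ x, lap^[k] u x = 0)
    (hgrowth :
      (fun r : ℝ => ⨆ x ∈ ball (0 : EuclideanSpace ℝ (Fin n)) r, |u x|) =o[atTop]
        (fun r : ℝ => r)) :
    ∃ c : ℝ, ∀ x, u x = c := by
  have hzero (x v : EuclideanSpace ℝ (Fin n)) : fderiv ℝ u x v = 0 := by
    have hpoly' (y) : lap^[k] (fun y => fderiv ℝ u y v) y = 0 := by
      have h0 : lap^[k] u = fun _ => 0 := funext hpoly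
      simp [iterate_lap_fderiv_apply k hu v, h0]
    obtain ⟨p, hp⟩ := exists_polynomial_bumpMean k 1 (contDiff_fderiv_apply hu v) hpoly' x
    have ht := tendsto_bumpMean_fderiv_apply 0 (hu.of_le (by simp)) hgrowth x v
    have hp0 : p = 0 := Polynomial.leadingCoeff_eq_zero.1
      (p.tendsto_nhds_iff.1 (ht.congr hp)).1
    have h0 := hp 0
    simp only [bumpMean, zero_smul, add_zero, hp0, Polynomial.eval_zero, integral_const_mul] at h0
    exact (mul_eq_zero.1 h0).resolve_right (integral_bump_pos 1).ne'
  exact ⟨u 0, fun x => is_const_of_fderiv_eq_zero (𝕜 := ℝ) (hu.differentiable (by simp))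
    (fun x => ContinuousLinearMap.ext (hzero x)) x 0⟩
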